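/- arXiv:2204.02690 — 4 statements merged into one kernel-verified Lean document; each statement's English description precedes it below -/
import Mathlib

section
/- ‖e^k‖ ≤ min{2M, (L/2)‖d^k‖} ‖d^k‖ + η_k (2α + M) ‖x^k − x*‖ + √2 η_k ‖v^k − v*‖. -/
open scoped Kronecker RealInnerProductSpace
open Filter Topology

/-- Spectral norm (ℓ2 operator norm) of a real square matrix. -/
noncomputable def specNorm {ι : Type*} [Fintype ι] [DecidableEq ι] (A : Matrix ι ι ℝ) : ℝ :=
  ‖Matrix.toEuclideanCLM (𝕜 := ℝ) A‖

/-- Action of a matrix on a vector of Euclidean space. -/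
noncomputable def mApp {ι : Type*} [Fintype ι] [DecidableEq ι]
    (A : Matrix ι ι ℝ) (x : EuclideanSpace ℝ ι) : EuclideanSpace ℝ ι :=
  Matrix.toEuclideanCLM (𝕜 := ℝ) A x

/-- Spectral radius of a real square matrix (computed over ℂ). -/
noncomputable def specRad {ι : Type*} [Fintype ι] [DecidableEq ι] (A : Matrix ι ι ℝ) : ℝ :=
  (spectralRadius ℂ (A.map (Complex.ofReal : ℝ → ℂ))).toReal

/-- The matrix 𝕎 = W ⊗ Iₙ. -/
noncomputable def WW (N n : ℕ) (W : Matrix (Fin N) (Fin N) ℝ) :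
    Matrix (Fin N × Fin n) (Fin N × Fin n) ℝ :=
  Matrix.kroneckerMap (· * ·) W (1 : Matrix (Fin n) (Fin n) ℝ)

/-- The i-th block component xᵢ ∈ ℝⁿ of x ∈ ℝ^{nN}. -/
noncomputable def comp (N n : ℕ) (x : EuclideanSpace ℝ (Fin N × Fin n)) (i : Fin N) :
    EuclideanSpace ℝ (Fin n) :=
  (EuclideanSpace.equiv (Fin n) ℝ).symm fun j => x (i, j)

/-- The block-diagonal Hessian ∇²f(x) of f(x) = Σᵢ fᵢ(xᵢ), from local Hessians HF i. -/
noncomputable def blockHess (N n : ℕ)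
    (HF : Fin N → EuclideanSpace ℝ (Fin n) → Matrix (Fin n) (Fin n) ℝ)
    (x : EuclideanSpace ℝ (Fin N × Fin n)) :
    Matrix (Fin N × Fin n) (Fin N × Fin n) ℝ :=
  Matrix.of fun p q =>
    if p.1 = q.1 then HF p.1 (comp N n x p.1) p.2 q.2 else 0

/-- The block norm ‖𝕋‖_b = max_i Σ_j ‖T_{ij}‖₂. -/
noncomputable def blockNorm {N n : ℕ} (T : Matrix (Fin N × Fin n) (Fin N × Fin n) ℝ) : ℝ :=
  ⨆ i : Fin N, ∑ j : Fin N, specNorm (Matrix.of fun (a b : Fin n) => T (i, a) (j, b))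

section MatrixBounds

variable {ι : Type*} [Fintype ι] [DecidableEq ι]

lemma mApp_add (A : Matrix ι ι ℝ) (x y : EuclideanSpace ℝ ι) :
    mApp A (x + y) = mApp A x + mApp A y := map_add _ _ _

lemma mApp_sub (A : Matrix ι ι ℝ) (x y : EuclideanSpace ℝ ι) :
    mApp A (x - y) = mApp A x - mApp A y := map_sub _ _ _

lemma mApp_mul (A B : Matrix ι ι ℝ) (x : EuclideanSpace ℝ ι) :
    mApp (A * B) x = mApp A (mApp B x) := by
  simp [mApp]

lemma Matrix.IsHermitian.inner_mApp {A : Matrix ι ι ℝ} (hA : A.IsHermitian)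
    (x y : EuclideanSpace ℝ ι) : ⟪mApp A x, y⟫ = ⟪x, mApp A y⟫ := by
  have h : ContinuousLinearMap.adjoint (Matrix.toEuclideanCLM (𝕜 := ℝ) A) =
      Matrix.toEuclideanCLM (𝕜 := ℝ) A := by
    rw [← ContinuousLinearMap.star_eq_adjoint, ← map_star, Matrix.star_eq_conjTranspose, hA.eq]
  have h2 := ContinuousLinearMap.adjoint_inner_left (Matrix.toEuclideanCLM (𝕜 := ℝ) A) y x
  rwa [h] at h2

lemma Matrix.PosSemidef.inner_mApp_nonneg {A : Matrix ι ι ℝ} (hA : A.PosSemidef)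
    (x : EuclideanSpace ℝ ι) : 0 ≤ ⟪x, mApp A x⟫ := by
  rw [mApp, Matrix.inner_toEuclideanCLM]
  simpa using hA.dotProduct_mulVec_nonneg x.ofLp

/-- A symmetric matrix whose quadratic form lies between `0` and `M ‖x‖²` has norm at most `M`. -/
lemma norm_mApp_le_of_quadratic_form {A : Matrix ι ι ℝ} (hA : A.IsHermitian) {M : ℝ} (hM : 0 < M)
    (h0 : ∀ x, 0 ≤ ⟪x, mApp A x⟫) (h1 : ∀ x, ⟪x, mApp A x⟫ ≤ M * ‖x‖ ^ 2)
    (x : EuclideanSpace ℝ ι) : ‖mApp A x‖ ≤ M * ‖x‖ := by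
  set y := mApp A x with hy
  have e1 := h1 (M • x + y)
  have e2 := h0 (M • x - y)
  have hxy : ⟪x, mApp A y⟫ = ‖y‖ ^ 2 := by
    rw [← hA.inner_mApp, ← hy, real_inner_self_eq_norm_sq]
  have e3 := mul_le_mul_of_nonneg_left (h1 x) (sq_nonneg M)
  rw [← hy] at e3
  have hs : mApp A (M • x) = M • y := map_smul _ _ _
  rw [mApp_add, hs, inner_add_left, inner_add_right, inner_add_right, real_inner_smul_left,
    real_inner_smul_left, real_inner_smul_right, real_inner_smul_right, hxy,
    real_inner_self_eq_norm_sq, norm_add_sq_real, norm_smul, real_inner_smul_left,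
    Real.norm_of_nonneg hM.le] at e1
  rw [mApp_sub, hs, inner_sub_left, inner_sub_right, inner_sub_right, real_inner_smul_left,
    real_inner_smul_left, real_inner_smul_right, real_inner_smul_right, hxy,
    real_inner_self_eq_norm_sq] at e2
  refine le_of_sq_le_sq ?_ (by positivity)
  refine le_of_mul_le_mul_left ?_ hM
  linarith

lemma norm_toEuclideanCLM_le {A : Matrix ι ι ℝ} {M : ℝ} (hM : 0 < M)
    (hA : A.PosSemidef) (hAM : (M • (1 : Matrix ι ι ℝ) - A).PosSemidef) :
    ‖Matrix.toEuclideanCLM (𝕜 := ℝ) A‖ ≤ M := by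
  refine ContinuousLinearMap.opNorm_le_bound _ hM.le fun x ↦ ?_
  refine norm_mApp_le_of_quadratic_form hA.1 hM hA.inner_mApp_nonneg (fun x ↦ ?_) x
  have h := hAM.inner_mApp_nonneg x
  simp only [mApp, map_sub, map_smul, map_one, sub_apply, inner_sub_right,
    smul_apply, one_apply_eq_self, real_inner_smul_right,
    real_inner_self_eq_norm_sq] at h
  simpa [mApp] using h

/-- The quadratic form of a doubly stochastic matrix is bounded below by `-‖x‖²`. -/
lemma neg_norm_sq_le_inner_mApp {A : Matrix ι ι ℝ} (h0 : ∀ i j, 0 ≤ A i j)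
    (hrow : ∀ i, ∑ j, A i j = 1) (hcol : ∀ j, ∑ i, A i j = 1) (x : EuclideanSpace ℝ ι) :
    -‖x‖ ^ 2 ≤ ⟪x, mApp A x⟫ := by
  rw [mApp, Matrix.inner_toEuclideanCLM, EuclideanSpace.real_norm_sq_eq]
  have h1 : ∑ i, ∑ j, A i j * x i ^ 2 = ∑ i, x i ^ 2 := by
    simp [← Finset.sum_mul, hrow]
  have h2 : ∑ i, ∑ j, A i j * x j ^ 2 = ∑ i, x i ^ 2 := by
    rw [Finset.sum_comm]
    simp [← Finset.sum_mul, hcol]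
  have h3 : x.ofLp ⬝ᵥ A.mulVec x.ofLp = ∑ i, ∑ j, A i j * (x i * x j) := by
    simp only [dotProduct, Matrix.mulVec, Finset.mul_sum]
    exact Finset.sum_congr rfl fun i _ ↦ Finset.sum_congr rfl fun j _ ↦ by ring
  have h4 : 0 ≤ ∑ i, ∑ j, A i j * (x i + x j) ^ 2 :=
    Finset.sum_nonneg fun i _ ↦ Finset.sum_nonneg fun j _ ↦ mul_nonneg (h0 i j) (sq_nonneg _)
  have h5 : ∑ i, ∑ j, A i j * (x i + x j) ^ 2 =
      ∑ i, ∑ j, A i j * x i ^ 2 + ∑ i, ∑ j, A i j * x j ^ 2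
        + 2 * ∑ i, ∑ j, A i j * (x i * x j) := by
    simp only [Finset.mul_sum, ← Finset.sum_add_distrib]
    exact Finset.sum_congr rfl fun i _ ↦ Finset.sum_congr rfl fun j _ ↦ by ring
  rw [h3]
  linarith

/-- If `S` is a symmetric square root of `1 - A` with `A` doubly stochastic, then `‖S‖ ≤ √2`. -/
lemma norm_mApp_sqrt_one_sub_le {A S : Matrix ι ι ℝ} (h0 : ∀ i j, 0 ≤ A i j)
    (hrow : ∀ i, ∑ j, A i j = 1) (hcol : ∀ j, ∑ i, A i j = 1) (hS : S.IsHermitian)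
    (hSA : S * S = 1 - A) (x : EuclideanSpace ℝ ι) : ‖mApp S x‖ ≤ √2 * ‖x‖ := by
  have h := neg_norm_sq_le_inner_mApp h0 hrow hcol x
  have h1 : mApp (1 - A) x = x - mApp A x := by simp [mApp]
  have h2 : ‖mApp S x‖ ^ 2 = ‖x‖ ^ 2 - ⟪x, mApp A x⟫ := by
    rw [← real_inner_self_eq_norm_sq, hS.inner_mApp, ← mApp_mul, hSA, h1, inner_sub_right,
      real_inner_self_eq_norm_sq]
  refine le_of_sq_le_sq ?_ (by positivity)
  rw [mul_pow, Real.sq_sqrt (by norm_num)]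
  linarith

end MatrixBounds

section Kronecker

variable {N n : ℕ} {W : Matrix (Fin N) (Fin N) ℝ}

lemma WW_nonneg (h : ∀ i j, 0 ≤ W i j) (p q : Fin N × Fin n) : 0 ≤ WW N n W p q := by
  rw [WW, Matrix.kroneckerMap_apply, Matrix.one_apply]
  exact mul_nonneg (h _ _) (by split_ifs <;> norm_num)

lemma sum_WW_row (h : ∀ i, ∑ j, W i j = 1) (p : Fin N × Fin n) : ∑ q, WW N n W p q = 1 := by
  simp [WW, Fintype.sum_prod_type, Matrix.one_apply, h]

lemma sum_WW_col (h : ∀ j, ∑ i, W i j = 1) (q : Fin N × Fin n) : ∑ p, WW N n W p q = 1 := by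
  simp [WW, Fintype.sum_prod_type, Matrix.one_apply, h]

end Kronecker

section Separable

variable {N n : ℕ}

/-- The block projection `x ↦ xᵢ` as a continuous linear map. -/
noncomputable def compCLM (N n : ℕ) (i : Fin N) :
    EuclideanSpace ℝ (Fin N × Fin n) →L[ℝ] EuclideanSpace ℝ (Fin n) :=
  LinearMap.toContinuousLinearMap
    { toFun := fun x ↦ comp N n x i
      map_add' := fun _ _ ↦ rfl
      map_smul' := fun _ _ ↦ rfl }

lemma compCLM_apply (i : Fin N) (x : EuclideanSpace ℝ (Fin N × Fin n)) :
    compCLM N n i x = comp N n x i := rfl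

lemma norm_sq_eq_sum_comp (x : EuclideanSpace ℝ (Fin N × Fin n)) :
    ‖x‖ ^ 2 = ∑ i, ‖comp N n x i‖ ^ 2 := by
  simp only [EuclideanSpace.real_norm_sq_eq, Fintype.sum_prod_type]
  rfl

lemma inner_eq_sum_comp (x y : EuclideanSpace ℝ (Fin N × Fin n)) :
    ⟪x, y⟫ = ∑ i, ⟪comp N n x i, comp N n y i⟫ := by
  simp only [PiLp.inner_apply, Fintype.sum_prod_type]
  rfl

lemma comp_gradient {F : Fin N → EuclideanSpace ℝ (Fin n) → ℝ}
    (hF : ∀ i, Differentiable ℝ (F i)) {f : EuclideanSpace ℝ (Fin N × Fin n) → ℝ}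
    (hf : ∀ x, f x = ∑ i, F i (comp N n x i)) (x : EuclideanSpace ℝ (Fin N × Fin n))
    (i : Fin N) : comp N n (gradient f x) i = gradient (F i) (comp N n x i) := by
  have key : HasGradientAt f
      (WithLp.toLp 2 fun p : Fin N × Fin n ↦ gradient (F p.1) (comp N n x p.1) p.2) x := by
    rw [hasGradientAt_iff_hasFDerivAt]
    have h : HasFDerivAt (fun x ↦ ∑ i, F i (compCLM N n i x))
        (∑ i, (InnerProductSpace.toDual ℝ _ (gradient (F i) (comp N n x i))).comp
          (compCLM N n i)) x :=
      HasFDerivAt.fun_sum fun i _ ↦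
        ((hF i _).hasGradientAt.hasFDerivAt).comp x (compCLM N n i).hasFDerivAt
    have hfe : f = fun x ↦ ∑ i, F i (compCLM N n i x) := funext hf
    rw [hfe]
    refine h.congr_fderiv ?_
    ext y
    rw [InnerProductSpace.toDual_apply_apply, inner_eq_sum_comp]
    simp only [sum_apply, ContinuousLinearMap.comp_apply,
      InnerProductSpace.toDual_apply_apply, compCLM_apply]
    rfl
  rw [key.gradient]
  rfl

/-- The gradient of a separable function is `M`-Lipschitz when the gradients of its parts are. -/
lemma norm_gradient_sub_le {F : Fin N → EuclideanSpace ℝ (Fin n) → ℝ}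
    (hF : ∀ i, Differentiable ℝ (F i)) {f : EuclideanSpace ℝ (Fin N × Fin n) → ℝ}
    (hf : ∀ x, f x = ∑ i, F i (comp N n x i)) {M : ℝ} (hM : 0 ≤ M)
    (hlip : ∀ i y z, ‖gradient (F i) y - gradient (F i) z‖ ≤ M * ‖y - z‖)
    (x z : EuclideanSpace ℝ (Fin N × Fin n)) :
    ‖gradient f x - gradient f z‖ ≤ M * ‖x - z‖ := by
  refine le_of_sq_le_sq ?_ (by positivity)
  rw [mul_pow, norm_sq_eq_sum_comp, norm_sq_eq_sum_comp, Finset.mul_sum]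
  refine Finset.sum_le_sum fun i _ ↦ ?_
  simp only [← compCLM_apply, map_sub]
  simp only [compCLM_apply, comp_gradient hF hf, ← mul_pow]
  exact pow_le_pow_left₀ (norm_nonneg _) (hlip i _ _) 2

end Separable

/-- First-order Taylor estimate for a map with Lipschitz derivative. -/
lemma norm_fderiv_apply_add_sub_le {E : Type*} [NormedAddCommGroup E] [NormedSpace ℝ E]
    {g : E → E} {g' : E → E →L[ℝ] E} (hg : ∀ x, HasFDerivAt g (g' x) x) {L : ℝ}
    (hL : ∀ x z, ‖g' x - g' z‖ ≤ L * ‖x - z‖) (x d : E) :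
    ‖g' x d + g x - g (x + d)‖ ≤ L / 2 * ‖d‖ * ‖d‖ := by
  have hφ : ∀ t : ℝ, HasDerivAt (fun t : ℝ ↦ t • g' x d + g x - g (x + t • d))
      (g' x d - g' (x + t • d) d) t := by
    intro t
    have h1 : HasDerivAt (fun t : ℝ ↦ x + t • d) d t := by
      simpa using ((hasDerivAt_id t).smul_const d).const_add x
    have h2 := (hg (x + t • d)).comp_hasDerivAt t h1
    have h3 : HasDerivAt (fun t : ℝ ↦ t • g' x d) (g' x d) t := by
      simpa using (hasDerivAt_id t).smul_const (g' x d)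
    exact (h3.add_const _).sub h2
  have hB : ∀ t : ℝ, HasDerivAt (fun t : ℝ ↦ L / 2 * ‖d‖ * ‖d‖ * t ^ 2) (L * ‖d‖ * ‖d‖ * t) t := by
    intro t
    refine ((hasDerivAt_pow 2 t).const_mul (L / 2 * ‖d‖ * ‖d‖)).congr_deriv ?_
    push_cast
    ring
  have := image_norm_le_of_norm_deriv_right_le_deriv_boundary (a := 0) (b := 1)
    (fun t _ ↦ (hφ t).continuousAt.continuousWithinAt) (fun t _ ↦ (hφ t).hasDerivWithinAt)
    (by simp) hB (fun t ht ↦ ?_) (Set.right_mem_Icc.2 zero_le_one)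
  · simpa using this
  · rw [← sub_apply]
    refine ((g' x - g' (x + t • d)).le_opNorm d).trans ?_
    have h := hL x (x + t • d)
    rw [sub_add_cancel_left, norm_neg, norm_smul, Real.norm_of_nonneg ht.1] at h
    calc _ ≤ L * (t * ‖d‖) * ‖d‖ := by gcongr
      _ = _ := by ring

theorem stmt4
    (N n : ℕ) (hN : 1 ≤ N) (hn : 1 ≤ n)
    (W : Matrix (Fin N) (Fin N) ℝ)
    (hWsymm : W.IsSymm)
    (hWnonneg : ∀ i j, 0 ≤ W i j)
    (hWrow : ∀ i, ∑ j, W i j = 1)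
    (hWcol : ∀ j, ∑ i, W i j = 1)
    (hWdiagpos : ∀ i, 0 < W i i)
    (m M : ℝ) (hm : 0 < m) (hmM : m ≤ M)
    (F : Fin N → EuclideanSpace ℝ (Fin n) → ℝ)
    (hFsmooth : ∀ i, ContDiff ℝ 2 (F i))
    (HF : Fin N → EuclideanSpace ℝ (Fin n) → Matrix (Fin n) (Fin n) ℝ)
    (hHF : ∀ i y, HasFDerivAt (gradient (F i)) (Matrix.toEuclideanCLM (𝕜 := ℝ) (HF i y)) y)
    (hHFlow : ∀ i y, (HF i y - m • (1 : Matrix (Fin n) (Fin n) ℝ)).PosSemidef)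
    (hHFup : ∀ i y, (M • (1 : Matrix (Fin n) (Fin n) ℝ) - HF i y).PosSemidef)
    (f : EuclideanSpace ℝ (Fin N × Fin n) → ℝ)
    (hf : ∀ x, f x = ∑ i, F i (comp N n x i))
    (Hf : EuclideanSpace ℝ (Fin N × Fin n) → Matrix (Fin N × Fin n) (Fin N × Fin n) ℝ)
    (hHfderiv : ∀ x, HasFDerivAt (gradient f) (Matrix.toEuclideanCLM (𝕜 := ℝ) (Hf x)) x)
    (L : ℝ) (hL : 0 < L)
    (hLip : ∀ x z, specNorm (Hf x - Hf z) ≤ L * ‖x - z‖)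
    (S : Matrix (Fin N × Fin n) (Fin N × Fin n) ℝ)
    (hSpsd : S.PosSemidef)
    (hSsq : S * S = 1 - WW N n W)
    (xstar vstar : EuclideanSpace ℝ (Fin N × Fin n))
    (hopt1 : gradient f xstar + mApp S vstar = 0)
    (hopt2 : mApp S xstar = 0)
    (α ε : ℝ) (hα : 0 < α) (hε : 0 < ε)
    (xk vk : EuclideanSpace ℝ (Fin N × Fin n))
    (qk : EuclideanSpace ℝ (Fin N × Fin n)) (hqk : qk = mApp S vk)
    (gk : EuclideanSpace ℝ (Fin N × Fin n))
    (hgk : gk = gradient f xk + qk + α • mApp (1 - WW N n W) xk)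
    (Hk : Matrix (Fin N × Fin n) (Fin N × Fin n) ℝ)
    (hHk : Hk = Hf xk + α • ((1 : Matrix (Fin N × Fin n) (Fin N × Fin n) ℝ) - WW N n W) + ε • 1)
    (dk rk : EuclideanSpace ℝ (Fin N × Fin n))
    (hstep : mApp Hk dk = -gk + rk)
    (xk1 : EuclideanSpace ℝ (Fin N × Fin n)) (hx1 : xk1 = xk + dk)
    (vk1 : EuclideanSpace ℝ (Fin N × Fin n)) (hv1 : vk1 = vk + α • mApp S xk1)
    (qk1 : EuclideanSpace ℝ (Fin N × Fin n)) (hq1 : qk1 = qk + α • mApp (1 - WW N n W) xk1)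
    (ek : EuclideanSpace ℝ (Fin N × Fin n))
    (hek : ek = mApp (Hf xk) dk + gradient f xk - gradient f xk1 - rk)
    (ηk : ℝ) (hηk : 0 ≤ ηk) (hres : ‖rk‖ ≤ ηk * ‖gk‖)
 :
    ‖ek‖ ≤ min (2 * M) (L / 2 * ‖dk‖) * ‖dk‖
      + ηk * (2 * α + M) * ‖xk - xstar‖ + Real.sqrt 2 * ηk * ‖vk - vstar‖ := by
  have hM : 0 < M := hm.trans_le hmM
  have hFdiff : ∀ i, Differentiable ℝ (F i) := fun i ↦ (hFsmooth i).differentiable (by norm_num)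
  have hHFpsd : ∀ i y, (HF i y).PosSemidef := fun i y ↦ by
    simpa using (hHFlow i y).add (Matrix.PosSemidef.one.smul hm.le)
  have hFlip : ∀ i y z, ‖gradient (F i) y - gradient (F i) z‖ ≤ M * ‖y - z‖ := fun i y z ↦
    convex_univ.norm_image_sub_le_of_norm_hasFDerivWithin_le
      (fun w _ ↦ (hHF i w).hasFDerivWithinAt)
      (fun w _ ↦ norm_toEuclideanCLM_le hM (hHFpsd i w) (hHFup i w)) trivial trivial
  have hlip := norm_gradient_sub_le hFdiff hf hM.le hFlip
  have hHfM : ‖mApp (Hf xk) dk‖ ≤ M * ‖dk‖ :=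
    ContinuousLinearMap.le_of_opNorm_le _
      ((hHfderiv xk).le_of_lip' hM.le (Eventually.of_forall fun x ↦ hlip x xk)) dk
  have hbound : ‖mApp (Hf xk) dk + gradient f xk - gradient f xk1‖
      ≤ min (2 * M) (L / 2 * ‖dk‖) * ‖dk‖ := by
    rw [hx1, min_mul_of_nonneg _ _ (norm_nonneg _)]
    refine le_min ?_ ?_
    · have h := hlip xk (xk + dk)
      rw [sub_add_cancel_left, norm_neg] at h
      rw [add_sub_assoc]
      linarith [norm_add_le (mApp (Hf xk) dk) (gradient f xk - gradient f (xk + dk))]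
    · exact norm_fderiv_apply_add_sub_le hHfderiv
        (fun x z ↦ by simpa [specNorm] using hLip x z) xk dk
  have hSn : ∀ y, ‖mApp S y‖ ≤ √2 * ‖y‖ :=
    norm_mApp_sqrt_one_sub_le (WW_nonneg hWnonneg) (sum_WW_row hWrow) (sum_WW_col hWcol)
      hSpsd.1 hSsq
  have hg : gk = (gradient f xk - gradient f xstar) + mApp S (vk - vstar)
      + α • mApp S (mApp S (xk - xstar)) := by
    rw [hgk, hqk, ← hSsq, mApp_mul, mApp_sub, mApp_sub, hopt2, sub_zero,
      eq_neg_of_add_eq_zero_left hopt1]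
    abel
  have hSS : ‖mApp S (mApp S (xk - xstar))‖ ≤ 2 * ‖xk - xstar‖ :=
    calc _ ≤ √2 * (√2 * ‖xk - xstar‖) := (hSn _).trans (by gcongr; exact hSn _)
      _ = 2 * ‖xk - xstar‖ := by rw [← mul_assoc, Real.mul_self_sqrt zero_le_two]
  have hgn : ‖gk‖ ≤ (2 * α + M) * ‖xk - xstar‖ + √2 * ‖vk - vstar‖ := by
    rw [hg]
    refine (norm_add₃_le).trans ?_
    rw [norm_smul, Real.norm_of_nonneg hα.le]
    have := mul_le_mul_of_nonneg_left hSS hα.le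
    linarith [hlip xk xstar, hSn (vk - vstar)]
  calc ‖ek‖ ≤ ‖mApp (Hf xk) dk + gradient f xk - gradient f xk1‖ + ‖rk‖ := hek ▸ norm_sub_le _ _
    _ ≤ min (2 * M) (L / 2 * ‖dk‖) * ‖dk‖
        + ηk * ((2 * α + M) * ‖xk - xstar‖ + √2 * ‖vk - vstar‖) :=
      add_le_add hbound (hres.trans (mul_le_mul_of_nonneg_left hgn hηk))
    _ = _ := by ring
end

section
/- For every ζ > 0: ‖u^{k+1} − u*‖²_G − ‖u^k − u*‖²_G ≤ −(2α/(m+M)) ‖∇f(x^{k+1}) − ∇f(x*)‖² − (x^{k+1} − x*)ᵀ[(2αmM/(m+M) − α/ζ) I + α²(I − 𝕎)](x^{k+1} − x*) − α ε ‖d^k‖² + α ζ ‖e^k‖². -/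
open scoped Kronecker RealInnerProductSpace
open Filter Topology

/-- A symmetric operator whose quadratic form is bounded by `r * ‖x‖ ^ 2` has norm at most `r`. -/
lemma norm_apply_le_of_abs_inner_self_le {E : Type*} [NormedAddCommGroup E]
    [InnerProductSpace ℝ E] (B : E →L[ℝ] E) (hB : ∀ x y, ⟪B x, y⟫ = ⟪B y, x⟫) {r : ℝ}
    (hr : 0 ≤ r) (h : ∀ x, |⟪B x, x⟫| ≤ r * ‖x‖ ^ 2) (x : E) : ‖B x‖ ≤ r * ‖x‖ := by
  have key : ∀ y : E, ⟪B x, y⟫ ≤ r / 2 * (‖x‖ ^ 2 + ‖y‖ ^ 2) := by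
    intro y
    have h1 := (abs_le.1 (h (x + y))).2
    have h2 := (abs_le.1 (h (x - y))).1
    have hp := parallelogram_law_with_norm ℝ x y
    simp only [map_add, map_sub, inner_add_left, inner_add_right, inner_sub_left,
      inner_sub_right] at h1 h2
    have hs := hB x y
    have hr' : r * ‖x + y‖ ^ 2 + r * ‖x - y‖ ^ 2 = r * (2 * (‖x‖ ^ 2 + ‖y‖ ^ 2)) := by
      linear_combination r * hp
    linarith
  refine abs_le_of_sq_le_sq' ?_ (by positivity) |>.2
  rcases hr.eq_or_lt with rfl | hr
  · have := key (B x)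
    rw [real_inner_self_eq_norm_sq] at this
    linarith
  · have := key (r⁻¹ • B x)
    rw [inner_smul_right, real_inner_self_eq_norm_sq, norm_smul, mul_pow, Real.norm_eq_abs,
      sq_abs] at this
    field_simp at this
    nlinarith

/-- Cocoercivity of a vector field whose Jacobian is symmetric with spectrum in `[m, M]`. -/
lemma inner_sub_ge_of_hasFDerivAt_posSemidef {ι : Type*} [Fintype ι] [DecidableEq ι] {m M : ℝ}
    (hmM : m ≤ M) {G : EuclideanSpace ℝ ι → EuclideanSpace ℝ ι}
    {H : EuclideanSpace ℝ ι → Matrix ι ι ℝ}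
    (hG : ∀ y, HasFDerivAt G (Matrix.toEuclideanCLM (𝕜 := ℝ) (H y)) y)
    (hlow : ∀ y, (H y - m • (1 : Matrix ι ι ℝ)).PosSemidef)
    (hup : ∀ y, (M • (1 : Matrix ι ι ℝ) - H y).PosSemidef) (x y : EuclideanSpace ℝ ι) :
    m * M * ‖x - y‖ ^ 2 + ‖G x - G y‖ ^ 2 ≤ (m + M) * ⟪x - y, G x - G y⟫ := by
  have hbound : ∀ z, ‖Matrix.toEuclideanCLM (𝕜 := ℝ) (H z) -
      ((m + M) / 2) • ContinuousLinearMap.id ℝ (EuclideanSpace ℝ ι)‖ ≤ (M - m) / 2 := by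
    intro z
    refine ContinuousLinearMap.opNorm_le_bound _ (by linarith) ?_
    have hA : ∀ A : Matrix ι ι ℝ, A.PosSemidef →
        ∀ u, 0 ≤ ⟪Matrix.toEuclideanCLM (𝕜 := ℝ) A u, u⟫ := by
      intro A hA u
      exact (Matrix.isPositive_toEuclideanLin_iff.2 hA).2 u
    have hS : ∀ u v, ⟪Matrix.toEuclideanCLM (𝕜 := ℝ) (H z - m • (1 : Matrix ι ι ℝ)) u, v⟫ =
        ⟪u, Matrix.toEuclideanCLM (𝕜 := ℝ) (H z - m • (1 : Matrix ι ι ℝ)) v⟫ := by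
      intro u v
      exact (Matrix.isPositive_toEuclideanLin_iff.2 (hlow z)).1 u v
    have hl := hA _ (hlow z)
    have hu := hA _ (hup z)
    simp only [map_sub, map_smul, map_one, sub_apply,
      smul_apply, one_apply_eq_self, inner_sub_left,
      inner_sub_right, real_inner_smul_left, real_inner_smul_right,
      real_inner_self_eq_norm_sq] at hl hu hS
    refine norm_apply_le_of_abs_inner_self_le _ ?_ (by linarith) ?_
    · intro u v
      have := hS u v
      simp only [sub_apply, smul_apply,
        ContinuousLinearMap.id_apply, inner_sub_left, real_inner_smul_left]
      rw [real_inner_comm u v, real_inner_comm u]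
      linarith
    · intro u
      have h1 := hl u
      have h2 := hu u
      simp only [sub_apply, smul_apply,
        ContinuousLinearMap.id_apply, inner_sub_left, real_inner_smul_left,
        real_inner_self_eq_norm_sq]
      exact abs_le.2 ⟨by linarith, by linarith⟩
  have hmv := Convex.norm_image_sub_le_of_norm_hasFDerivWithin_le' (s := Set.univ)
    (fun z _ => (hG z).hasFDerivWithinAt) (fun z _ => hbound z) convex_univ
    (Set.mem_univ y) (Set.mem_univ x)
  have hsq := pow_le_pow_left₀ (norm_nonneg _) hmv 2
  rw [smul_apply, ContinuousLinearMap.id_apply, norm_sub_sq_real, norm_smul,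
    mul_pow, mul_pow, Real.norm_eq_abs, sq_abs, real_inner_smul_right, real_inner_comm] at hsq
  linarith

lemma inner_eq_sum_inner_comp {N n : ℕ} (x y : EuclideanSpace ℝ (Fin N × Fin n)) :
    ⟪x, y⟫ = ∑ i, ⟪comp N n x i, comp N n y i⟫ := by
  simp [PiLp.inner_apply, comp, Fintype.sum_prod_type]

/-- The projection onto a block, as a continuous linear map. -/
noncomputable def compL (N n : ℕ) (i : Fin N) :
    EuclideanSpace ℝ (Fin N × Fin n) →L[ℝ] EuclideanSpace ℝ (Fin n) :=
  LinearMap.toContinuousLinearMap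
    { toFun := fun x => comp N n x i
      map_add' := fun _ _ => rfl
      map_smul' := fun _ _ => rfl }

@[simp]
lemma compL_apply {N n : ℕ} (i : Fin N) (x : EuclideanSpace ℝ (Fin N × Fin n)) :
    compL N n i x = comp N n x i := rfl

lemma comp_sub {N n : ℕ} (x y : EuclideanSpace ℝ (Fin N × Fin n)) (i : Fin N) :
    comp N n (x - y) i = comp N n x i - comp N n y i := rfl

/-- The gradient of a separable function acts blockwise. -/
lemma comp_gradient_of_eq_sum {N n : ℕ} {F : Fin N → EuclideanSpace ℝ (Fin n) → ℝ}
    (hF : ∀ i, Differentiable ℝ (F i)) {f : EuclideanSpace ℝ (Fin N × Fin n) → ℝ}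
    (hf : ∀ x, f x = ∑ i, F i (comp N n x i)) (x : EuclideanSpace ℝ (Fin N × Fin n))
    (i : Fin N) : comp N n (gradient f x) i = gradient (F i) (comp N n x i) := by
  have hgrad : HasGradientAt f
      (WithLp.toLp 2 fun p : Fin N × Fin n => gradient (F p.1) (comp N n x p.1) p.2) x := by
    rw [hasGradientAt_iff_hasFDerivAt]
    have hsum : HasFDerivAt (fun z => ∑ i, F i (compL N n i z))
        (∑ i, (InnerProductSpace.toDual ℝ _ (gradient (F i) (comp N n x i))).comp
          (compL N n i)) x :=
      HasFDerivAt.fun_sum fun i _ =>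
        HasFDerivAt.comp x (g := F i) (hF i _).hasGradientAt.hasFDerivAt
          (compL N n i).hasFDerivAt
    rw [show f = fun z => ∑ i, F i (compL N n i z) from funext hf]
    refine hsum.congr_fderiv (ContinuousLinearMap.ext fun v => ?_)
    rw [sum_apply, InnerProductSpace.toDual_apply_apply, inner_eq_sum_inner_comp]
    refine Finset.sum_congr rfl fun i _ => ?_
    rw [ContinuousLinearMap.comp_apply, InnerProductSpace.toDual_apply_apply, compL_apply]
    rfl
  rw [hgrad.gradient]
  rfl

theorem stmt7
    (N n : ℕ) (hN : 1 ≤ N) (hn : 1 ≤ n)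
    (W : Matrix (Fin N) (Fin N) ℝ)
    (hWsymm : W.IsSymm)
    (hWnonneg : ∀ i j, 0 ≤ W i j)
    (hWrow : ∀ i, ∑ j, W i j = 1)
    (hWcol : ∀ j, ∑ i, W i j = 1)
    (hWdiagpos : ∀ i, 0 < W i i)
    (m M : ℝ) (hm : 0 < m) (hmM : m ≤ M)
    (F : Fin N → EuclideanSpace ℝ (Fin n) → ℝ)
    (hFsmooth : ∀ i, ContDiff ℝ 2 (F i))
    (HF : Fin N → EuclideanSpace ℝ (Fin n) → Matrix (Fin n) (Fin n) ℝ)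
    (hHF : ∀ i y, HasFDerivAt (gradient (F i)) (Matrix.toEuclideanCLM (𝕜 := ℝ) (HF i y)) y)
    (hHFlow : ∀ i y, (HF i y - m • (1 : Matrix (Fin n) (Fin n) ℝ)).PosSemidef)
    (hHFup : ∀ i y, (M • (1 : Matrix (Fin n) (Fin n) ℝ) - HF i y).PosSemidef)
    (f : EuclideanSpace ℝ (Fin N × Fin n) → ℝ)
    (hf : ∀ x, f x = ∑ i, F i (comp N n x i))
    (Hf : EuclideanSpace ℝ (Fin N × Fin n) → Matrix (Fin N × Fin n) (Fin N × Fin n) ℝ)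
    (hHfderiv : ∀ x, HasFDerivAt (gradient f) (Matrix.toEuclideanCLM (𝕜 := ℝ) (Hf x)) x)
    (L : ℝ) (hL : 0 < L)
    (hLip : ∀ x z, specNorm (Hf x - Hf z) ≤ L * ‖x - z‖)
    (S : Matrix (Fin N × Fin n) (Fin N × Fin n) ℝ)
    (hSpsd : S.PosSemidef)
    (hSsq : S * S = 1 - WW N n W)
    (xstar vstar : EuclideanSpace ℝ (Fin N × Fin n))
    (hopt1 : gradient f xstar + mApp S vstar = 0)
    (hopt2 : mApp S xstar = 0)
    (α ε : ℝ) (hα : 0 < α) (hε : 0 < ε)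
    (xk vk : EuclideanSpace ℝ (Fin N × Fin n))
    (qk : EuclideanSpace ℝ (Fin N × Fin n)) (hqk : qk = mApp S vk)
    (gk : EuclideanSpace ℝ (Fin N × Fin n))
    (hgk : gk = gradient f xk + qk + α • mApp (1 - WW N n W) xk)
    (Hk : Matrix (Fin N × Fin n) (Fin N × Fin n) ℝ)
    (hHk : Hk = Hf xk + α • ((1 : Matrix (Fin N × Fin n) (Fin N × Fin n) ℝ) - WW N n W) + ε • 1)
    (dk rk : EuclideanSpace ℝ (Fin N × Fin n))
    (hstep : mApp Hk dk = -gk + rk)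
    (xk1 : EuclideanSpace ℝ (Fin N × Fin n)) (hx1 : xk1 = xk + dk)
    (vk1 : EuclideanSpace ℝ (Fin N × Fin n)) (hv1 : vk1 = vk + α • mApp S xk1)
    (qk1 : EuclideanSpace ℝ (Fin N × Fin n)) (hq1 : qk1 = qk + α • mApp (1 - WW N n W) xk1)
    (ek : EuclideanSpace ℝ (Fin N × Fin n))
    (hek : ek = mApp (Hf xk) dk + gradient f xk - gradient f xk1 - rk)
 :
    ∀ ζ : ℝ, 0 < ζ →
      (‖vk1 - vstar‖ ^ 2 + α * ε * ‖xk1 - xstar‖ ^ 2)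
          - (‖vk - vstar‖ ^ 2 + α * ε * ‖xk - xstar‖ ^ 2)
        ≤ -(2 * α / (m + M)) * ‖gradient f xk1 - gradient f xstar‖ ^ 2
          - ⟪xk1 - xstar,
              mApp ((2 * α * m * M / (m + M) - α / ζ)
                  • (1 : Matrix (Fin N × Fin n) (Fin N × Fin n) ℝ)
                + α ^ 2 • ((1 : Matrix (Fin N × Fin n) (Fin N × Fin n) ℝ) - WW N n W))
                (xk1 - xstar)⟫
          - α * ε * ‖dk‖ ^ 2 + α * ζ * ‖ek‖ ^ 2 := by
  intro ζ hζ
  have hco : m * M * ‖xk1 - xstar‖ ^ 2 + ‖gradient f xk1 - gradient f xstar‖ ^ 2 ≤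
      (m + M) * ⟪xk1 - xstar, gradient f xk1 - gradient f xstar⟫ := by
    have hblock := Finset.sum_le_sum fun i (_ : i ∈ Finset.univ) =>
      inner_sub_ge_of_hasFDerivAt_posSemidef hmM (hHF i) (hHFlow i) (hHFup i)
        (comp N n xk1 i) (comp N n xstar i)
    have hgrad := comp_gradient_of_eq_sum
      (fun i => (hFsmooth i).differentiable (by norm_num)) hf
    simp only [← real_inner_self_eq_norm_sq, inner_eq_sum_inner_comp (N := N), comp_sub, hgrad,
      Finset.mul_sum, ← Finset.sum_add_distrib] at hblock ⊢
    exact hblock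
  have hsymm : ∀ u v, ⟪mApp S u, v⟫ = ⟪u, mApp S v⟫ := fun u v =>
    (Matrix.isPositive_toEuclideanLin_iff.2 hSpsd).1 u v
  have hSS : ∀ u, mApp (1 - WW N n W) u = mApp S (mApp S u) := by
    intro u
    rw [← hSsq]
    simp [mApp]
  have hres : ε • dk = -(ek + (gradient f xk1 - gradient f xstar) + mApp S (vk1 - vstar)) := by
    have h1 : mApp Hk dk = mApp (Hf xk) dk + α • mApp (1 - WW N n W) dk + ε • dk := by
      rw [hHk]; simp [mApp]
    have h2 : mApp (1 - WW N n W) xk1 = mApp (1 - WW N n W) xk + mApp (1 - WW N n W) dk := by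
      rw [hx1]; exact map_add _ _ _
    have h3 : mApp S (vk1 - vstar) =
        qk + α • mApp (1 - WW N n W) xk1 + gradient f xstar := by
      rw [eq_neg_of_add_eq_zero_left hopt1, hv1, hqk, hSS]
      simp [mApp]
      abel
    rw [h3, h2, hek]
    rw [h1, hgk] at hstep
    rw [smul_add]
    have hstep' := eq_sub_of_add_eq' hstep
    rw [hstep']
    abel
  have hSx : mApp S xk1 = mApp S (xk1 - xstar) := by
    have : mApp S (xk1 - xstar) = mApp S xk1 - mApp S xstar := map_sub _ _ _
    rw [this, hopt2, sub_zero]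
  have hv : ‖vk - vstar‖ ^ 2 = ‖vk1 - vstar‖ ^ 2
      - 2 * α * ⟪xk1 - xstar, mApp S (vk1 - vstar)⟫
      + α ^ 2 * ⟪xk1 - xstar, mApp (1 - WW N n W) (xk1 - xstar)⟫ := by
    rw [show vk - vstar = (vk1 - vstar) - α • mApp S (xk1 - xstar) by
        rw [hv1, hSx]; abel, norm_sub_sq_real, hSS, ← hsymm, ← hsymm, real_inner_smul_right,
      norm_smul, mul_pow, Real.norm_eq_abs, sq_abs, real_inner_self_eq_norm_sq,
      real_inner_comm (vk1 - vstar)]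
    ring
  have hx : ‖xk - xstar‖ ^ 2 = ‖xk1 - xstar‖ ^ 2 - 2 * ⟪xk1 - xstar, dk⟫ + ‖dk‖ ^ 2 := by
    rw [show xk - xstar = (xk1 - xstar) - dk by rw [hx1]; abel, norm_sub_sq_real]
  have hd : ε * ⟪xk1 - xstar, dk⟫ = -(⟪xk1 - xstar, ek⟫
      + ⟪xk1 - xstar, gradient f xk1 - gradient f xstar⟫
      + ⟪xk1 - xstar, mApp S (vk1 - vstar)⟫) := by
    rw [← real_inner_smul_right, hres, inner_neg_right, inner_add_right, inner_add_right]
  have hyoung : -(2 * ⟪xk1 - xstar, ek⟫) ≤ ‖xk1 - xstar‖ ^ 2 / ζ + ζ * ‖ek‖ ^ 2 := by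
    have h := sq_nonneg ‖(xk1 - xstar) + ζ • ek‖
    rw [norm_add_sq_real, norm_smul, mul_pow, Real.norm_eq_abs, sq_abs,
      real_inner_smul_right] at h
    have h' := div_nonneg h hζ.le
    field_simp at h' ⊢
    linarith
  have hmat : ⟪xk1 - xstar,
      mApp ((2 * α * m * M / (m + M) - α / ζ)
          • (1 : Matrix (Fin N × Fin n) (Fin N × Fin n) ℝ)
        + α ^ 2 • ((1 : Matrix (Fin N × Fin n) (Fin N × Fin n) ℝ) - WW N n W))
        (xk1 - xstar)⟫ = (2 * α * m * M / (m + M) - α / ζ) * ‖xk1 - xstar‖ ^ 2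
      + α ^ 2 * ⟪xk1 - xstar, mApp (1 - WW N n W) (xk1 - xstar)⟫ := by
    simp only [mApp, map_add, map_smul, map_one, add_apply,
      smul_apply, one_apply_eq_self, inner_add_right,
      real_inner_smul_right, real_inner_self_eq_norm_sq]
  have hmM' : 0 < m + M := by linarith
  have hco' : 2 * α / (m + M) * ‖gradient f xk1 - gradient f xstar‖ ^ 2
      + 2 * α * m * M / (m + M) * ‖xk1 - xstar‖ ^ 2 ≤
      2 * α * ⟪xk1 - xstar, gradient f xk1 - gradient f xstar⟫ := by
    have h := mul_le_mul_of_nonneg_left hco (show 0 ≤ 2 * α / (m + M) by positivity)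
    field_simp at h ⊢
    linarith
  have hy' := mul_le_mul_of_nonneg_left hyoung hα.le
  have hdiv : α / ζ * ‖xk1 - xstar‖ ^ 2 = α * (‖xk1 - xstar‖ ^ 2 / ζ) := by ring
  rw [hmat, hv, hx]
  linear_combination hco' + hy' + 2 * α * hd + hdiv
end

section
/- Let A ∈ ℝ^{p×p} be symmetric with m I ⪯ A ⪯ M I for real numbers m ≤ M. Then ‖A − diag(A)‖₂ ≤ M − m, where diag(A) denotes the diagonal matrix with the same diagonal as A. -/
open scoped Kronecker RealInnerProductSpace
open Filter Topology

/-- A real symmetric matrix `B` with `-c I ⪯ B ⪯ c I` has spectral norm at most `c`. -/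
theorem specNorm_le_of_posSemidef {ι : Type*} [Fintype ι] [DecidableEq ι] {B : Matrix ι ι ℝ}
    {c : ℝ} (hc : 0 ≤ c) (hB : B.IsHermitian)
    (hup : (c • (1 : Matrix ι ι ℝ) - B).PosSemidef)
    (hlow : (B + c • (1 : Matrix ι ι ℝ)).PosSemidef) :
    specNorm B ≤ c := by
  have hsymm : (Matrix.toEuclideanCLM (𝕜 := ℝ) B).IsSymmetric :=
    Matrix.isSymmetric_toEuclideanLin_iff.mpr hB
  rw [specNorm, ContinuousLinearMap.norm_eq_iSup_rayleighQuotient _ hsymm]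
  refine Real.iSup_le (fun x => ?_) hc
  have hinner : (Matrix.toEuclideanCLM (𝕜 := ℝ) B).reApplyInnerSelf x
      = x.ofLp ⬝ᵥ B.mulVec x.ofLp := by
    rw [ContinuousLinearMap.reApplyInnerSelf_apply, RCLike.re_to_real, real_inner_comm,
      Matrix.inner_toEuclideanCLM]
  have hnorm : ‖x‖ ^ 2 = x.ofLp ⬝ᵥ x.ofLp := by
    simp only [EuclideanSpace.real_norm_sq_eq, dotProduct, ← sq]
  have h₁ := hup.dotProduct_mulVec_nonneg x.ofLp
  have h₂ := hlow.dotProduct_mulVec_nonneg x.ofLp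
  simp only [star_trivial, Matrix.sub_mulVec, Matrix.add_mulVec, Matrix.smul_mulVec,
    Matrix.one_mulVec, dotProduct_sub, dotProduct_add, dotProduct_smul, smul_eq_mul,
    ← hinner, ← hnorm] at h₁ h₂
  rw [ContinuousLinearMap.rayleighQuotient, abs_div, abs_of_nonneg (sq_nonneg ‖x‖)]
  exact div_le_of_le_mul₀ (sq_nonneg _) hc (abs_le.mpr ⟨by linarith, by linarith⟩)

theorem stmt11
    (p : ℕ) (hp : 1 ≤ p) (m M : ℝ) (hmM : m ≤ M)
    (A : Matrix (Fin p) (Fin p) ℝ) (hA : A.IsSymm)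
    (hlow : (A - m • (1 : Matrix (Fin p) (Fin p) ℝ)).PosSemidef)
    (hup : (M • (1 : Matrix (Fin p) (Fin p) ℝ) - A).PosSemidef) :
    specNorm (A - Matrix.diagonal (fun i => A i i)) ≤ M - m := by
  have hAm (i : Fin p) : 0 ≤ A i i - m := by
    simpa using hlow.diag_nonneg (i := i)
  have hAM (i : Fin p) : 0 ≤ M - A i i := by
    simpa using hup.diag_nonneg (i := i)
  refine specNorm_le_of_posSemidef (sub_nonneg.mpr hmM) ?_ ?_ ?_
  · exact Matrix.IsHermitian.sub hA (Matrix.isHermitian_diagonal _)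
  · convert hup.add (Matrix.PosSemidef.diagonal hAm) using 1
    ext i j
    by_cases hij : i = j
    · subst hij
      simp
    · simp [hij]
  · convert hlow.add (Matrix.PosSemidef.diagonal hAM) using 1
    ext i j
    by_cases hij : i = j
    · subst hij
      simp
    · simp [hij]
end

section
/- Let D ∈ ℝ^{p×p} be diagonal and positive definite, G ∈ ℝ^{p×p} symmetric, γ ∈ ℝ, and T_γ := γ D^{-1} G + (1 − γ) I. Then σ(T_γ) = ‖D^{-1/2}(γ G + (1 − γ) D) D^{-1/2}‖₂, and for every ℓ ∈ ℕ and every u ∈ ℝ^p: ‖T_γ^ℓ u‖ ≤ (σ(T_γ))^ℓ · √(λ_max(D)/λ_min(D)) · ‖u‖, where λ_max(D) and λ_min(D) are the largest and smallest diagonal entries of D. -/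
open scoped Kronecker RealInnerProductSpace
open Filter Topology

/-- Complexifying a real matrix does not change its spectral norm. -/
theorem norm_toEuclideanCLM_map_ofReal {ι : Type*} [Fintype ι] [DecidableEq ι]
    (A : Matrix ι ι ℝ) :
    ‖Matrix.toEuclideanCLM (𝕜 := ℂ) (A.map (Complex.ofReal : ℝ → ℂ))‖ = specNorm A := by
  have hre (x : EuclideanSpace ℂ ι) (i : ι) :
      (Matrix.toEuclideanCLM (𝕜 := ℂ) (A.map (Complex.ofReal : ℝ → ℂ)) x i).re =
        Matrix.toEuclideanCLM (𝕜 := ℝ) A (WithLp.toLp 2 fun j => (x j).re) i := by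
    simp [Matrix.ofLp_toEuclideanCLM, Matrix.mulVec, dotProduct]
  have him (x : EuclideanSpace ℂ ι) (i : ι) :
      (Matrix.toEuclideanCLM (𝕜 := ℂ) (A.map (Complex.ofReal : ℝ → ℂ)) x i).im =
        Matrix.toEuclideanCLM (𝕜 := ℝ) A (WithLp.toLp 2 fun j => (x j).im) i := by
    simp [Matrix.ofLp_toEuclideanCLM, Matrix.mulVec, dotProduct]
  have hsq (z : EuclideanSpace ℂ ι) :
      ‖z‖ ^ 2 = ‖(WithLp.toLp 2 fun j => (z j).re : EuclideanSpace ℝ ι)‖ ^ 2 +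
        ‖(WithLp.toLp 2 fun j => (z j).im : EuclideanSpace ℝ ι)‖ ^ 2 := by
    simp only [EuclideanSpace.norm_sq_eq, ← Finset.sum_add_distrib]
    refine Finset.sum_congr rfl fun j _ => ?_
    rw [Complex.sq_norm, Complex.normSq_apply, Real.norm_eq_abs, Real.norm_eq_abs, sq_abs, sq_abs]
    ring
  unfold specNorm
  apply le_antisymm
  · refine ContinuousLinearMap.opNorm_le_bound _ (norm_nonneg _) fun x => ?_
    refine (sq_le_sq₀ (by positivity) (by positivity)).mp ?_
    rw [hsq, mul_pow, hsq x, mul_add, ← mul_pow, ← mul_pow]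
    simp only [hre, him]
    exact add_le_add
      (pow_le_pow_left₀ (norm_nonneg _) ((Matrix.toEuclideanCLM (𝕜 := ℝ) A).le_opNorm _) 2)
      (pow_le_pow_left₀ (norm_nonneg _) ((Matrix.toEuclideanCLM (𝕜 := ℝ) A).le_opNorm _) 2)
  · refine ContinuousLinearMap.opNorm_le_bound _ (norm_nonneg _) fun x => ?_
    have h := ContinuousLinearMap.le_opNorm
      (Matrix.toEuclideanCLM (𝕜 := ℂ) (A.map (Complex.ofReal : ℝ → ℂ)))
      (WithLp.toLp 2 fun j => (x j : ℂ))
    have hx : ‖(WithLp.toLp 2 fun j => (x j : ℂ) : EuclideanSpace ℂ ι)‖ = ‖x‖ := by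
      simp [EuclideanSpace.norm_eq]
    rw [hx] at h
    refine le_trans ?_ h
    refine (sq_le_sq₀ (by positivity) (by positivity)).mp ?_
    rw [hsq]
    simp only [hre, him]
    exact le_add_of_nonneg_right (sq_nonneg _)

/-- The spectral radius of a real symmetric matrix is its spectral norm. -/
theorem Matrix.IsSymm.specRad_eq_specNorm {ι : Type*} [Fintype ι] [DecidableEq ι]
    {A : Matrix ι ι ℝ} (hA : A.IsSymm) : specRad A = specNorm A := by
  have hsa : IsSelfAdjoint (A.map (Complex.ofReal : ℝ → ℂ)) := by
    ext i j
    simp [Matrix.star_apply, hA.apply i j]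
  rw [← norm_toEuclideanCLM_map_ofReal,
    ← (hsa.map (Matrix.toEuclideanCLM (𝕜 := ℂ) (n := ι))).toReal_spectralRadius_complex_eq_norm]
  simp only [specRad, spectralRadius, AlgEquiv.spectrum_eq]

/-- The spectral radius is invariant under similarity. -/
theorem specRad_conj {ι : Type*} [Fintype ι] [DecidableEq ι]
    {P Q : Matrix ι ι ℝ} (hPQ : P * Q = 1) (A : Matrix ι ι ℝ) :
    specRad (P * A * Q) = specRad A := by
  let f := (Complex.ofRealHom.mapMatrix : Matrix ι ι ℝ →+* Matrix ι ι ℂ)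
  let u : (Matrix ι ι ℂ)ˣ :=
    ⟨f P, f Q, by rw [← map_mul, hPQ, map_one], by rw [← map_mul, mul_eq_one_comm.mp hPQ, map_one]⟩
  have h : spectrum ℂ (f (P * A * Q)) = spectrum ℂ (f A) := by
    rw [map_mul, map_mul]
    exact spectrum.units_conjugate (u := u)
  change (spectralRadius ℂ (f (P * A * Q))).toReal = (spectralRadius ℂ (f A)).toReal
  simp only [spectralRadius, h]

theorem specNorm_mul_le {ι : Type*} [Fintype ι] [DecidableEq ι] (A B : Matrix ι ι ℝ) :
    specNorm (A * B) ≤ specNorm A * specNorm B := by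
  unfold specNorm
  rw [map_mul]
  exact norm_mul_le _ _

theorem specNorm_pow_le {ι : Type*} [Fintype ι] [DecidableEq ι] (A : Matrix ι ι ℝ) (k : ℕ) :
    specNorm (A ^ k) ≤ specNorm A ^ k := by
  unfold specNorm
  rw [map_pow]
  induction k with
  | zero => simpa [ContinuousLinearMap.one_def] using ContinuousLinearMap.norm_id_le
  | succ k ih =>
    rw [pow_succ, pow_succ]
    exact (norm_mul_le _ _).trans (by gcongr)

theorem specNorm_diagonal_le {ι : Type*} [Fintype ι] [DecidableEq ι] {v : ι → ℝ} {c : ℝ}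
    (hc : 0 ≤ c) (hv : ∀ i, |v i| ≤ c) : specNorm (Matrix.diagonal v) ≤ c := by
  unfold specNorm
  rw [Matrix.l2_opNorm_toEuclideanCLM, Matrix.l2_opNorm_diagonal]
  exact (pi_norm_le_iff_of_nonneg hc).mpr hv

theorem stmt13
    (p : ℕ) (hp : 1 ≤ p)
    (dd : Fin p → ℝ)
    (D : Matrix (Fin p) (Fin p) ℝ) (hDdiag : D = Matrix.diagonal dd)
    (hDpd : D.PosDef)
    (G : Matrix (Fin p) (Fin p) ℝ) (hGsymm : G.IsSymm)
    (γ : ℝ)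
    (Tγ : Matrix (Fin p) (Fin p) ℝ)
    (hTγ : Tγ = γ • (D⁻¹ * G) + (1 - γ) • 1)
    (Dinvhalf : Matrix (Fin p) (Fin p) ℝ)
    (hDinvhalf : Dinvhalf = Matrix.diagonal (fun i => 1 / Real.sqrt (dd i))) :
    specRad Tγ = specNorm (Dinvhalf * (γ • G + (1 - γ) • D) * Dinvhalf) ∧
    ∀ (ℓ : ℕ) (u : EuclideanSpace ℝ (Fin p)),
      ‖mApp (Tγ ^ ℓ) u‖ ≤ specRad Tγ ^ ℓ * Real.sqrt ((⨆ i, dd i) / (⨅ i, dd i)) * ‖u‖ := by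
  have hd : ∀ i, 0 < dd i := by
    rw [hDdiag] at hDpd
    exact Matrix.posDef_diagonal_iff.mp hDpd
  have hs : ∀ i, √(dd i) ≠ 0 := fun i => (Real.sqrt_pos.mpr (hd i)).ne'
  set S := Dinvhalf * (γ • G + (1 - γ) • D) * Dinvhalf with hS
  set H := Matrix.diagonal fun i => √(dd i) with hH
  have hPH : Dinvhalf * H = 1 := by
    rw [hDinvhalf, hH, Matrix.diagonal_mul_diagonal, ← Matrix.diagonal_one]
    congr 1
    ext i
    exact one_div_mul_cancel (hs i)
  have hHP : H * Dinvhalf = 1 := mul_eq_one_comm.mp hPH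
  have hDH : D = H * H := by
    rw [hDdiag, hH, Matrix.diagonal_mul_diagonal]
    congr 1
    ext i
    exact (Real.mul_self_sqrt (hd i).le).symm
  have hDi : D⁻¹ = Dinvhalf * Dinvhalf := by
    apply Matrix.inv_eq_left_inv
    rw [hDH, mul_assoc, ← mul_assoc Dinvhalf H H, hPH, one_mul, hPH]
  have hSsymm : S.IsSymm := by
    have hG : G.transpose = G := hGsymm
    rw [Matrix.IsSymm, hS, hDinvhalf, hDdiag]
    simp [Matrix.transpose_mul, hG, mul_assoc]
  have hT : Tγ = Dinvhalf * S * H := by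
    have h1 : S * H = Dinvhalf * (γ • G + (1 - γ) • D) := by
      rw [hS, mul_assoc, hPH, mul_one]
    have h2 : Dinvhalf * Dinvhalf * D = 1 := by
      rw [hDH, mul_assoc, ← mul_assoc Dinvhalf H H, hPH, one_mul, hPH]
    rw [mul_assoc, h1, ← mul_assoc, mul_add, mul_smul_comm, mul_smul_comm, h2, hTγ, hDi]
  have hrad : specRad Tγ = specNorm S := by
    rw [hT, specRad_conj hPH, hSsymm.specRad_eq_specNorm]
  refine ⟨hrad, fun ℓ u => ?_⟩
  have hpow : Tγ ^ ℓ = Dinvhalf * S ^ ℓ * H := by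
    induction ℓ with
    | zero => rw [pow_zero, pow_zero, mul_one, hPH]
    | succ k ih =>
      calc Tγ ^ (k + 1) = Dinvhalf * S ^ k * (H * Dinvhalf) * S * H := by
            rw [pow_succ, ih, hT]; simp only [mul_assoc]
        _ = Dinvhalf * S ^ (k + 1) * H := by rw [hHP, mul_one, pow_succ]; simp only [mul_assoc]
  have : Nonempty (Fin p) := ⟨⟨0, hp⟩⟩
  have hinf : 0 < ⨅ i, dd i := by
    obtain ⟨i, hi⟩ := exists_eq_ciInf_of_finite (f := dd)
    exact hi ▸ hd i
  have hHn : specNorm H ≤ √(⨆ i, dd i) := by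
    refine specNorm_diagonal_le (Real.sqrt_nonneg _) fun i => ?_
    rw [abs_of_nonneg (Real.sqrt_nonneg _)]
    exact Real.sqrt_le_sqrt (le_ciSup (Set.finite_range dd).bddAbove i)
  have hPn : specNorm Dinvhalf ≤ 1 / √(⨅ i, dd i) := by
    rw [hDinvhalf]
    refine specNorm_diagonal_le (by positivity) fun i => ?_
    rw [abs_of_nonneg (by positivity)]
    exact one_div_le_one_div_of_le (Real.sqrt_pos.mpr hinf)
      (Real.sqrt_le_sqrt (ciInf_le (Set.finite_range dd).bddBelow i))
  have hnn (A : Matrix (Fin p) (Fin p) ℝ) : 0 ≤ specNorm A := norm_nonneg _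
  have hTn : specNorm (Tγ ^ ℓ) ≤ specRad Tγ ^ ℓ * √((⨆ i, dd i) / (⨅ i, dd i)) := by
    calc specNorm (Tγ ^ ℓ) ≤ specNorm Dinvhalf * specNorm (S ^ ℓ) * specNorm H := by
          rw [hpow]
          exact (specNorm_mul_le _ _).trans
            (mul_le_mul_of_nonneg_right (specNorm_mul_le _ _) (hnn H))
      _ ≤ 1 / √(⨅ i, dd i) * specNorm S ^ ℓ * √(⨆ i, dd i) := by
          have hSl := specNorm_pow_le S ℓ
          have := hnn S
          have := hnn (S ^ ℓ)
          have := hnn H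
          gcongr
      _ = specRad Tγ ^ ℓ * √((⨆ i, dd i) / (⨅ i, dd i)) := by
          rw [hrad, Real.sqrt_div' _ hinf.le]
          ring
  exact (ContinuousLinearMap.le_opNorm _ u).trans
    (mul_le_mul_of_nonneg_right hTn (norm_nonneg u))
end
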